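/- arXiv:2309.06314 — 2 statements merged into one kernel-verified Lean document; each statement's English description precedes it below -/
import Mathlib

section
/- Let R be a commutative ring, V a finite free R-module with a flag V_0 ⊂ V_1 ⊂ ... ⊂ V_k of free submodules with free quotients (V_0 = 0, V_k = V), and let τ be a cyclic endomorphism of V preserving the flag. Then each induced endomorphism τ_j on V_j/V_{j−1} is cyclic. -/
section Flags

variable {R V : Type*} [CommRing R] [AddCommGroup V] [Module R V]

/-- `v` generates the module under the action of `R[τ]`. -/
def IsCyclicVec (τ : Module.End R V) (v : V) : Prop :=
  ∀ w : V, ∃ p : Polynomial R, Polynomial.aeval τ p v = w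

/-- `τ` is cyclic: it admits a cyclic vector. -/
def IsCyclicEnd (τ : Module.End R V) : Prop := ∃ v, IsCyclicVec τ v

/-- The `j`-th step `V_j` of the flag, viewed inside `V_{j+1}`. -/
abbrev flagSub {k : ℕ} (W : Fin (k + 1) → Submodule R V) (j : Fin k) :
    Submodule R (W j.succ) :=
  (W j.castSucc).comap (W j.succ).subtype

/-- The `j`-th subquotient `V_{j+1}/V_j` of the flag. -/
abbrev FlagQuot {k : ℕ} (W : Fin (k + 1) → Submodule R V) (j : Fin k) :=
  W j.succ ⧸ flagSub W j

/-- The endomorphism induced on the subquotient `V_{j+1}/V_j` by a flag-preserving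
endomorphism `τ`. -/
def inducedEnd {k : ℕ} (W : Fin (k + 1) → Submodule R V) (τ : Module.End R V)
    (hτ : ∀ j, ∀ x ∈ W j, τ x ∈ W j) (j : Fin k) :
    Module.End R (FlagQuot W j) :=
  Submodule.mapQ (flagSub W j) (flagSub W j)
    (τ.restrict (fun x hx => hτ j.succ x hx))
    (fun x hx => hτ j.castSucc x.1 hx)

end Flags

open Polynomial in
/-- The annihilator of a cyclic vector of an endomorphism of a finite free module is generated by
the characteristic polynomial. -/
theorem IsCyclicVec.charpoly_dvd {R Q : Type*} [CommRing R] [Nontrivial R] [AddCommGroup Q]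
    [Module R Q] [Module.Free R Q] [Module.Finite R Q] {σ : Module.End R Q} {v : Q}
    (hv : IsCyclicVec σ v) {p : R[X]} (hp : aeval σ p v = 0) : σ.charpoly ∣ p := by
  have hmonic := σ.charpoly_monic
  have hmod (q : R[X]) : aeval σ (q %ₘ σ.charpoly) v = aeval σ q v := by
    conv_rhs => rw [← modByMonic_add_div q σ.charpoly]
    simp [σ.aeval_self_charpoly]
  have hdeg (q : R[X]) : q %ₘ σ.charpoly ∈ degreeLT R (Module.finrank R Q) := by
    rw [mem_degreeLT, ← σ.charpoly_natDegree, ← degree_eq_natDegree hmonic.ne_zero]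
    exact degree_modByMonic_lt q hmonic
  let ev : degreeLT R (Module.finrank R Q) →ₗ[R] Q :=
    (LinearMap.applyₗ v ∘ₗ (aeval σ).toLinearMap) ∘ₗ (degreeLT R _).subtype
  have hsurj : Function.Surjective ev := fun w => by
    obtain ⟨q, rfl⟩ := hv w
    exact ⟨⟨_, hdeg q⟩, hmod q⟩
  let e : degreeLT R (Module.finrank R Q) ≃ₗ[R] Q :=
    (degreeLTEquiv R _).trans (Module.finBasis R Q).equivFun.symm
  have hinj : Function.Injective ev :=
    OrzechProperty.injective_of_surjective_of_injective e.toLinearMap ev e.injective hsurj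
  have h0 : (⟨_, hdeg p⟩ : degreeLT R (Module.finrank R Q)) = 0 :=
    hinj (((hmod p).trans hp).trans (map_zero ev).symm)
  exact (modByMonic_eq_zero_iff_dvd hmonic).mp (congrArg Subtype.val h0)

open Polynomial in
theorem aeval_apply_of_semiconj {R M N : Type*} [CommRing R] [AddCommGroup M] [Module R M]
    [AddCommGroup N] [Module R N] {σ : Module.End R M} {σ' : Module.End R N} {f : M →ₗ[R] N}
    (h : ∀ x, f (σ x) = σ' (f x)) (p : R[X]) (x : M) :
    f (aeval σ p x) = aeval σ' p (f x) := by
  have hpow (n : ℕ) (x : M) : f ((σ ^ n) x) = (σ' ^ n) (f x) := by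
    induction n generalizing x with
    | zero => rfl
    | succ n ih => rw [pow_succ, pow_succ, Module.End.mul_apply, Module.End.mul_apply, ih, h]
  induction p using Polynomial.induction_on' with
  | add p q hp hq => simp [hp, hq]
  | monomial n a => simp [aeval_monomial, hpow]

theorem IsCyclicEnd.of_surjective {R M N : Type*} [CommRing R] [AddCommGroup M] [Module R M]
    [AddCommGroup N] [Module R N] {σ : Module.End R M} {σ' : Module.End R N} {f : M →ₗ[R] N}
    (hσ : IsCyclicEnd σ) (hf : Function.Surjective f) (h : ∀ x, f (σ x) = σ' (f x)) :
    IsCyclicEnd σ' := by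
  obtain ⟨v, hv⟩ := hσ
  refine ⟨f v, fun w => ?_⟩
  obtain ⟨x, rfl⟩ := hf w
  obtain ⟨p, rfl⟩ := hv x
  exact ⟨p, (aeval_apply_of_semiconj h p v).symm⟩

/-- A cyclic endomorphism restricts to a cyclic endomorphism of the kernel of any equivariant
surjection onto a finite free module. -/
theorem IsCyclicEnd.of_ker {R K M Q : Type*} [CommRing R] [AddCommGroup K] [Module R K]
    [AddCommGroup M] [Module R M] [AddCommGroup Q] [Module R Q] [Module.Free R Q]
    [Module.Finite R Q] {σK : Module.End R K} {σ : Module.End R M} {σQ : Module.End R Q}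
    {i : K →ₗ[R] M} {f : M →ₗ[R] Q} (hσ : IsCyclicEnd σ) (hi : Function.Injective i)
    (hf : Function.Surjective f) (hif : Function.Exact i f)
    (hσi : ∀ x, i (σK x) = σ (i x)) (hσf : ∀ x, f (σ x) = σQ (f x)) : IsCyclicEnd σK := by
  cases subsingleton_or_nontrivial R
  · have := Module.subsingleton R K
    exact ⟨0, fun w => ⟨0, Subsingleton.elim _ _⟩⟩
  obtain ⟨v, hv⟩ := hσ
  have hfv : IsCyclicVec σQ (f v) := fun w => by
    obtain ⟨x, rfl⟩ := hf w
    obtain ⟨p, rfl⟩ := hv x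
    exact ⟨p, (aeval_apply_of_semiconj hσf p v).symm⟩
  obtain ⟨u, hu⟩ : ∃ u, i u = Polynomial.aeval σ σQ.charpoly v := by
    refine (hif _).mp ?_
    rw [aeval_apply_of_semiconj hσf, σQ.aeval_self_charpoly, LinearMap.zero_apply]
  refine ⟨u, fun w => ?_⟩
  obtain ⟨p, hp⟩ := hv (i w)
  obtain ⟨q, rfl⟩ : σQ.charpoly ∣ p := hfv.charpoly_dvd <| by
    rw [← aeval_apply_of_semiconj hσf, hp]
    exact (hif _).mpr ⟨w, rfl⟩
  refine ⟨q, hi ?_⟩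
  rw [aeval_apply_of_semiconj hσi, hu, ← hp, mul_comm, map_mul, Module.End.mul_apply]

/-- Let `R` be a commutative ring, `V` a finite free `R`-module with a flag
`0 = V_0 ⊂ V_1 ⊂ ⋯ ⊂ V_k = V` of free submodules with free quotients, and let `τ` be a cyclic
endomorphism of `V` preserving the flag.  Then each induced endomorphism on `V_j/V_{j-1}` is
cyclic. -/
theorem stmt_5 {R V : Type*} [CommRing R] [AddCommGroup V] [Module R V]
    [Module.Free R V] [Module.Finite R V]
    (k : ℕ) (W : Fin (k + 1) → Submodule R V)
    (hmono : Monotone W) (hbot : W 0 = ⊥) (htop : W (Fin.last k) = ⊤)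
    (hWfree : ∀ j, Module.Free R (W j))
    (hQfree : ∀ j : Fin k, Module.Free R (FlagQuot W j))
    (τ : Module.End R V) (hτ : ∀ j, ∀ x ∈ W j, τ x ∈ W j)
    (hcyc : IsCyclicEnd τ) :
    ∀ j : Fin k, IsCyclicEnd (inducedEnd W τ hτ j) := by
  have main : ∀ j : Fin (k + 1), Module.Finite R (W j) ∧
      IsCyclicEnd (τ.restrict (fun x hx => hτ j x hx)) := by
    intro j
    induction j using Fin.reverseInduction with
    | last =>
      let e : V ≃ₗ[R] W (Fin.last k) :=
        Submodule.topEquiv.symm.trans (LinearEquiv.ofEq _ _ htop.symm)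
      exact ⟨Module.Finite.equiv e,
        hcyc.of_surjective (f := e.toLinearMap) e.surjective fun _ => rfl⟩
    | cast j ih =>
      obtain ⟨hfin, hc⟩ := ih
      have := hQfree j
      let i := Submodule.inclusion (hmono j.castSucc_le_succ)
      have hi : Function.Injective i := Submodule.inclusion_injective _
      have hif : LinearMap.range i = flagSub W j := Submodule.range_inclusion _ _ _
      refine ⟨?_, hc.of_ker (σQ := inducedEnd W τ hτ j) hi (flagSub W j).mkQ_surjective
        (LinearMap.exact_iff.mpr ((flagSub W j).ker_mkQ.trans hif.symm))
        (fun _ => rfl) (fun _ => rfl)⟩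
      have hfg : (flagSub W j).FG := by
        have := Module.finitePresentation_of_projective R (FlagQuot W j)
        have := Module.FinitePresentation.fg_ker (flagSub W j).mkQ (flagSub W j).mkQ_surjective
        rwa [Submodule.ker_mkQ] at this
      have : Module.Finite R (LinearMap.range i) := Module.Finite.iff_fg.mpr (hif ▸ hfg)
      exact Module.Finite.equiv (LinearEquiv.ofInjective i hi).symm
  exact fun j => (main j.succ).2.of_surjective (flagSub W j).mkQ_surjective fun _ => rfl
end

section
/- Let R be a commutative ring and V_1 ⊂ ... ⊂ V_k a flag in a finite free R-module V, with cyclic endomorphisms τ_j ∈ End(V_j/V_{j−1}) given for each j. Then there exists a cyclic endomorphism τ of V that preserves the flag and induces τ_j on each quotient V_j/V_{j−1}. -/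
section Splicing

open Polynomial

variable {R : Type*} [CommRing R]
  {M N Q : Type*} [AddCommGroup M] [Module R M] [AddCommGroup N] [Module R N]
  [AddCommGroup Q] [Module R Q]

theorem map_aeval_apply_of_intertwines (f : M →ₗ[R] N) (α : Module.End R M) (β : Module.End R N)
    (h : ∀ x, f (α x) = β (f x)) (p : R[X]) (x : M) :
    f (aeval α p x) = aeval β p (f x) := by
  have hpow : ∀ n : ℕ, f ((α ^ n) x) = (β ^ n) (f x) := by
    intro n
    induction n with
    | zero => simp
    | succ n ih => rw [pow_succ', pow_succ', Module.End.mul_apply, Module.End.mul_apply, h, ih]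
  induction p using Polynomial.induction_on' with
  | add p q hp hq => simp [hp, hq]
  | monomial n a => simp [aeval_monomial, hpow, Module.algebraMap_end_apply]

theorem IsCyclicVec.conj {τ : Module.End R M} {v : M} (h : IsCyclicVec τ v) (e : M ≃ₗ[R] N) :
    IsCyclicVec (e.conj τ) (e v) := by
  intro w
  obtain ⟨p, hp⟩ := h (e.symm w)
  refine ⟨p, ?_⟩
  rw [← e.coe_coe, ← map_aeval_apply_of_intertwines (e : M →ₗ[R] N) τ (e.conj τ)
    (fun x => by simp [LinearEquiv.conj_apply]), hp]
  simp

theorem IsCyclicEnd.conj {τ : Module.End R M} (h : IsCyclicEnd τ) (e : M ≃ₗ[R] N) :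
    IsCyclicEnd (e.conj τ) :=
  let ⟨v, hv⟩ := h
  ⟨e v, hv.conj e⟩

theorem IsCyclicVec.top_le_span_pow [Nontrivial R] [Module.Free R Q] [Module.Finite R Q]
    {σ : Module.End R Q} {w : Q} (h : IsCyclicVec σ w) (hd : 0 < Module.finrank R Q) :
    ⊤ ≤ Submodule.span R (Set.range fun i : Fin (Module.finrank R Q) => (σ ^ (i : ℕ)) w) := by
  rintro q -
  obtain ⟨p, rfl⟩ := h q
  have hne : σ.charpoly ≠ 1 := fun h1 => by
    have := σ.charpoly_natDegree
    rw [h1, natDegree_one] at this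
    omega
  have hlt := natDegree_modByMonic_lt p σ.charpoly_monic hne
  rw [σ.charpoly_natDegree] at hlt
  rw [← aeval_modByMonic_eq_self_of_root σ.aeval_self_charpoly, aeval_eq_sum_range' hlt,
    LinearMap.sum_apply]
  refine Submodule.sum_mem _ fun i hi => ?_
  rw [LinearMap.smul_apply]
  exact Submodule.smul_mem _ _ (Submodule.subset_span ⟨⟨i, Finset.mem_range.mp hi⟩, rfl⟩)

/-- A functional dual to the last vector of the cyclic basis `w, σ w, …, σ ^ d w`. -/
theorem IsCyclicVec.exists_functional [Nontrivial R] [Module.Free R Q] [Module.Finite R Q]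
    {σ : Module.End R Q} {w : Q} (h : IsCyclicVec σ w) {d : ℕ}
    (hd : Module.finrank R Q = d + 1) :
    ∃ φ : Q →ₗ[R] R, (∀ i < d, φ ((σ ^ i) w) = 0) ∧ φ ((σ ^ d) w) = 1 := by
  have hspan := h.top_le_span_pow (by omega)
  let b := Module.Basis.mk
    (linearIndependent_of_top_le_span_of_card_eq_finrank hspan (by simp)) hspan
  have hb : ∀ i, b i = (σ ^ (i : ℕ)) w := fun i => by simp [b]
  refine ⟨b.coord ⟨d, by omega⟩, fun i hi => ?_, ?_⟩
  · rw [← hb ⟨i, by omega⟩, Module.Basis.coord_apply, Module.Basis.repr_self,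
      Finsupp.single_eq_of_ne (by simp [Fin.ext_iff]; omega)]
  · rw [← hb ⟨d, by omega⟩, Module.Basis.coord_apply, Module.Basis.repr_self,
      Finsupp.single_eq_same]

theorem exists_cyclic_prod [Module.Free R Q] [Module.Finite R Q]
    {α : Module.End R N} {σ : Module.End R Q} (hα : IsCyclicEnd α) (hσ : IsCyclicEnd σ) :
    ∃ τ : Module.End R (N × Q), IsCyclicEnd τ ∧ (∀ n, τ (n, 0) = (α n, 0)) ∧
      ∀ x, (τ x).2 = σ x.2 := by
  obtain ⟨v, hv⟩ := hα
  obtain ⟨w, hw⟩ := hσ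
  rcases subsingleton_or_nontrivial Q with hQ | hQ
  · have hinl : ∀ n, α.prodMap σ (n, 0) = (α n, 0) := by simp
    refine ⟨α.prodMap σ, ⟨(v, 0), fun ⟨n, q⟩ => ?_⟩, hinl, by simp⟩
    obtain ⟨p, rfl⟩ := hv n
    refine ⟨p, ?_⟩
    rw [← LinearMap.inl_apply (R := R), ← map_aeval_apply_of_intertwines _ α _ (by simp)]
    exact Prod.ext rfl (Subsingleton.elim _ _)
  have : Nontrivial R := Module.nontrivial R Q
  obtain ⟨d, hd⟩ := Nat.exists_eq_succ_of_ne_zero ((Module.finrank_pos_iff_of_free R Q).mpr hQ).ne'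
  obtain ⟨φ, hφ₀, hφ₁⟩ := hw.exists_functional hd
  let τ : Module.End R (N × Q) :=
    (α.coprod (φ.smulRight v)).prod (σ ∘ₗ LinearMap.snd R N Q)
  have hτ : ∀ n q, τ (n, q) = (α n + φ q • v, σ q) := fun n q => rfl
  have hinl : ∀ n, τ (n, 0) = (α n, 0) := by simp [hτ]
  have hsnd : ∀ (p : R[X]) x, (aeval τ p x).2 = aeval σ p x.2 :=
    map_aeval_apply_of_intertwines (LinearMap.snd R N Q) τ σ fun _ => rfl
  have hpow : ∀ i ≤ d, (τ ^ i) (0, w) = (0, (σ ^ i) w) := by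
    intro i
    induction i with
    | zero => simp
    | succ i ih =>
      intro hi
      rw [pow_succ', Module.End.mul_apply, ih (by omega), hτ, hφ₀ i (by omega), pow_succ',
        Module.End.mul_apply]
      simp
  have hχ : aeval τ σ.charpoly (0, w) = (v, 0) := by
    refine Prod.ext ?_ (by rw [hsnd, σ.aeval_self_charpoly]; rfl)
    have hdeg : σ.charpoly.natDegree = d + 1 := σ.charpoly_natDegree.trans hd
    have hlead : σ.charpoly.coeff (d + 1) = 1 := by
      rw [← hdeg]; exact σ.charpoly_monic.coeff_natDegree
    rw [aeval_eq_sum_range, hdeg, Finset.sum_range_succ, hlead, one_smul, LinearMap.add_apply,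
      LinearMap.sum_apply, Finset.sum_congr rfl fun i hi => by
        rw [LinearMap.smul_apply, hpow i (by simpa [Nat.lt_succ_iff] using hi)],
      pow_succ', Module.End.mul_apply, hpow d le_rfl, hτ, hφ₁]
    simp [Prod.fst_sum]
  refine ⟨τ, ⟨(0, w), fun ⟨n, q⟩ => ?_⟩, hinl, fun _ => rfl⟩
  obtain ⟨p, hp⟩ := hw q
  obtain ⟨r, hr⟩ := hv (n - (aeval τ p (0, w)).1)
  refine ⟨p + r * σ.charpoly, ?_⟩
  rw [map_add, map_mul, LinearMap.add_apply, Module.End.mul_apply, hχ,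
    ← LinearMap.inl_apply (R := R),
    ← map_aeval_apply_of_intertwines (LinearMap.inl R N Q) α τ (fun x => (hinl x).symm), hr]
  exact Prod.ext (by simp) (by simp [hsnd, hp])

theorem Function.Exact.exists_prod_equiv [Module.Projective R Q] {i : N →ₗ[R] M} {π : M →ₗ[R] Q}
    (h : Function.Exact i π) (hi : Function.Injective i) (hπ : Function.Surjective π) :
    ∃ e : M ≃ₗ[R] N × Q, (∀ n, e (i n) = (n, 0)) ∧ ∀ x, (e x).2 = π x := by
  obtain ⟨s, hs⟩ := Module.projective_lifting_property π .id hπ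
  obtain ⟨e, he, he'⟩ := h.splitSurjectiveEquiv hi ⟨s, hs⟩
  exact ⟨e, by simp [he], by simp [he']⟩

theorem Function.Exact.exists_cyclic [Module.Free R Q] [Module.Finite R Q]
    {i : N →ₗ[R] M} {π : M →ₗ[R] Q}
    (h : Function.Exact i π) (hi : Function.Injective i) (hπ : Function.Surjective π)
    {α : Module.End R N} {σ : Module.End R Q} (hα : IsCyclicEnd α) (hσ : IsCyclicEnd σ) :
    ∃ τ : Module.End R M, IsCyclicEnd τ ∧ (∀ n, τ (i n) = i (α n)) ∧
      ∀ x, π (τ x) = σ (π x) := by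
  obtain ⟨e, hei, heπ⟩ := h.exists_prod_equiv hi hπ
  obtain ⟨τ, hτ, hinl, hsnd⟩ := exists_cyclic_prod hα hσ
  refine ⟨e.symm.conj τ, hτ.conj e.symm, fun n => ?_, fun x => ?_⟩
  · simp [LinearEquiv.conj_apply, hei, hinl, LinearEquiv.symm_apply_eq]
  · simp [LinearEquiv.conj_apply, ← heπ, hsnd]

end Splicing

section FlagLemmas

variable {R V : Type*} [CommRing R] [AddCommGroup V] [Module R V] {k : ℕ}
  {W : Fin (k + 1) → Submodule R V}

theorem flag_exact (hmono : Monotone W) (j : Fin k) :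
    Function.Exact (Submodule.inclusion (hmono j.castSucc_le_succ)) (flagSub W j).mkQ := by
  rw [LinearMap.exact_iff, Submodule.ker_mkQ, Submodule.range_inclusion]

theorem flag_finite [Module.Finite R V] (hmono : Monotone W) (htop : W (Fin.last k) = ⊤)
    (hQfree : ∀ j : Fin k, Module.Free R (FlagQuot W j)) (j : Fin (k + 1)) :
    Module.Finite R (W j) := by
  induction j using Fin.reverseInduction with
  | last => exact Module.Finite.equiv (LinearEquiv.ofTop _ htop).symm
  | cast j ih =>
    have := hQfree j
    obtain ⟨e, -⟩ := (flag_exact hmono j).exists_prod_equiv (Submodule.inclusion_injective _)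
      (Submodule.mkQ_surjective _)
    exact Module.Finite.of_surjective (LinearMap.fst R _ _ ∘ₗ e.toLinearMap)
      (Prod.fst_surjective.comp e.surjective)

theorem exists_cyclic_flag_step (hmono : Monotone W) (hbot : W 0 = ⊥)
    (hQfree : ∀ j : Fin k, Module.Free R (FlagQuot W j))
    (hQfin : ∀ j : Fin k, Module.Finite R (FlagQuot W j))
    (σ : ∀ j : Fin k, Module.End R (FlagQuot W j)) (hσ : ∀ j, IsCyclicEnd (σ j))
    (j : Fin (k + 1)) :
    ∃ τ : Module.End R (W j), IsCyclicEnd τ ∧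
      ∀ (i : Fin k) (hij : i.succ ≤ j) (x : W i.succ), ∃ y : W i.succ,
        (y : V) = τ (Submodule.inclusion (hmono hij) x) ∧
          (flagSub W i).mkQ y = σ i ((flagSub W i).mkQ x) := by
  induction j using Fin.induction with
  | zero =>
    refine ⟨0, ⟨0, fun w => ⟨0, ?_⟩⟩, fun i hi => absurd hi (by simp)⟩
    have hw : (w : V) = 0 := by simpa [hbot] using w.2
    simpa using (Subtype.ext hw).symm
  | succ j ih =>
    obtain ⟨α, hα, hαi⟩ := ih
    have := hQfree j
    have := hQfin j
    obtain ⟨τ, hτ, hτα, hτσ⟩ := (flag_exact hmono j).exists_cyclic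
      (Submodule.inclusion_injective _) (Submodule.mkQ_surjective _) hα (hσ j)
    refine ⟨τ, hτ, fun i hij x => ?_⟩
    rcases hij.eq_or_lt with h | h
    · obtain rfl := Fin.succ_injective _ h
      exact ⟨τ x, rfl, hτσ x⟩
    · have hle : i.succ ≤ j.castSucc := Fin.le_castSucc_iff.mpr h
      obtain ⟨y, hy, hyσ⟩ := hαi i hle x
      refine ⟨y, ?_, hyσ⟩
      have := hτα (Submodule.inclusion (hmono hle) x)
      rw [Submodule.inclusion_apply] at this
      exact hy.trans (congrArg Subtype.val this).symm

end FlagLemmas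

/-- Let `R` be a commutative ring and `0 = V_0 ⊂ V_1 ⊂ ⋯ ⊂ V_k = V` a flag in a finite free
`R`-module, with cyclic endomorphisms `σ_j` of the quotients `V_j/V_{j-1}` given.  Then there
exists a cyclic endomorphism `τ` of `V` preserving the flag and inducing `σ_j` on each
quotient. -/
theorem stmt_6 {R V : Type*} [CommRing R] [AddCommGroup V] [Module R V]
    [Module.Free R V] [Module.Finite R V]
    (k : ℕ) (W : Fin (k + 1) → Submodule R V)
    (hmono : Monotone W) (hbot : W 0 = ⊥) (htop : W (Fin.last k) = ⊤)
    (hWfree : ∀ j, Module.Free R (W j))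
    (hQfree : ∀ j : Fin k, Module.Free R (FlagQuot W j))
    (σ : ∀ j : Fin k, Module.End R (FlagQuot W j))
    (hσ : ∀ j, IsCyclicEnd (σ j)) :
    ∃ (τ : Module.End R V) (hτ : ∀ j, ∀ x ∈ W j, τ x ∈ W j),
      IsCyclicEnd τ ∧ ∀ j : Fin k, inducedEnd W τ hτ j = σ j := by
  have hfin := flag_finite hmono htop hQfree
  obtain ⟨τ, hτ, hτσ⟩ := exists_cyclic_flag_step hmono hbot hQfree
    (fun j => inferInstance) σ hσ (Fin.last k)
  let e := LinearEquiv.ofTop _ htop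
  have hstep : ∀ (i : Fin k) (x : W i.succ), ∃ y : W i.succ,
      (y : V) = e.conj τ x ∧ (flagSub W i).mkQ y = σ i ((flagSub W i).mkQ x) := fun i x =>
    hτσ i (Fin.le_last _) x
  have hpres : ∀ j, ∀ x ∈ W j, e.conj τ x ∈ W j := by
    intro j
    refine Fin.cases ?_ (fun i => ?_) j
    · simp [hbot]
    · intro x hx
      obtain ⟨y, hy, -⟩ := hstep i ⟨x, hx⟩
      exact hy ▸ y.2
  refine ⟨e.conj τ, hpres, hτ.conj e, fun j =>
    Submodule.linearMap_qext _ (LinearMap.ext fun x => ?_)⟩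
  obtain ⟨y, hy, hyσ⟩ := hstep j x
  refine Eq.trans ?_ hyσ
  exact congrArg (flagSub W j).mkQ (Subtype.ext hy.symm)
end
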